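/- For every acceptance mode (σ,ρ) with σ ∈ {ran, inf} and ρ ∈ {⊓, ⊆, =}, every ω-language (σ,ρ,nl)-accepted by a phrase structure ω-grammar is (σ,ρ)-accepted by some 2-tape Turing ω-machine: 𝓛_{σ,ρ,nl}(ω-PSG) ⊆ 𝓛_{σ,ρ}(2-ω-TM). -/

import Mathlib

namespace OmegaFormal

/-- σ component of an acceptance mode: `ran` (occurs at least once)
or `inf` (occurs infinitely often). -/
inductive AccSigma | ran | inf
deriving DecidableEq

/-- ρ component of an acceptance mode: `cap` (nonempty intersection, ⊓),
`sub` (⊆) or `eq` (=). -/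
inductive AccRho | cap | sub | eq
deriving DecidableEq

/-- derivation mode: leftmost (`l`) or normal (`nl`). -/
inductive DerivMode | l | nl
deriving DecidableEq

/-- `sigmaSet σ f` is ran(f) resp. inf(f). -/
def sigmaSet {Q : Type _} : AccSigma → (ℕ → Q) → Set Q
  | .ran, f => Set.range f
  | .inf, f => {q | ∀ n : ℕ, ∃ m : ℕ, n ≤ m ∧ f m = q}

/-- the binary relation denoted by ρ. -/
def rhoRel {Q : Type _} : AccRho → Set Q → Set Q → Prop
  | .cap, A, B => (A ∩ B).Nonempty
  | .sub, A, B => A ⊆ B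
  | .eq,  A, B => A = B

/-- f is (σ,ρ)-accepting w.r.t. the set 𝓕 of designated sets. -/
def IsAccepting {Q : Type _} (σ : AccSigma) (ρ : AccRho) (𝓕 : Set (Set Q)) (f : ℕ → Q) : Prop :=
  ∃ F ∈ 𝓕, rhoRel ρ (sigmaSet σ f) F

/-- the finite word `l` coincides with the prefix of the ω-word `u`. -/
def MatchesPrefix {T : Type _} (l : List T) (u : ℕ → T) : Prop :=
  ∀ (k : ℕ) (h : k < l.length), l.get ⟨k, h⟩ = u k

/-- the maximal terminal prefix of a sentential form. -/
def termPrefix {N T : Type _} : List (N ⊕ T) → List T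
  | [] => []
  | (Sum.inl _) :: _ => []
  | (Sum.inr a) :: l => a :: termPrefix l

/-- A phrase structure ω-grammar `G = (N, T, P, S, 𝓕)`:
`N` nonterminals, `T` terminals, `P` named productions `p : lhs p → rhs p`
with `lhs p ∈ N⁺`, `rhs p ∈ (N ∪ T)*`, start symbol, and
production repetition sets `acc ⊆ 2^P`. -/
structure OmegaPSG (T : Type) where
  N : Type
  [fintypeN : Fintype N]
  P : Type
  [fintypeP : Fintype P]
  lhs : P → List N
  lhs_ne : ∀ p : P, lhs p ≠ []
  rhs : P → List (N ⊕ T)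
  start : N
  acc : Set (Set P)

namespace OmegaPSG

variable {T : Type} (G : OmegaPSG T)

/-- one (normal) rewriting step using production p. -/
def Step (p : G.P) (x y : List (G.N ⊕ T)) : Prop :=
  ∃ u v : List (G.N ⊕ T),
    x = u ++ (G.lhs p).map Sum.inl ++ v ∧ y = u ++ G.rhs p ++ v

/-- one leftmost rewriting step: the rewritten occurrence starts at the
leftmost nonterminal, i.e. everything to its left is terminal. -/
def LStep (p : G.P) (x y : List (G.N ⊕ T)) : Prop :=
  ∃ u v : List (G.N ⊕ T), (∀ s ∈ u, ∃ a : T, s = Sum.inr a) ∧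
    x = u ++ (G.lhs p).map Sum.inl ++ v ∧ y = u ++ G.rhs p ++ v

def StepOf : DerivMode → G.P → List (G.N ⊕ T) → List (G.N ⊕ T) → Prop
  | .l => G.LStep
  | .nl => G.Step

/-- `L_{σ,ρ,π}(G)`: ω-words admitting an infinite π-derivation from S whose
growing terminal prefixes spell the word and whose production sequence is
(σ,ρ)-accepting w.r.t. `G.acc`. -/
def Lang (σ : AccSigma) (ρ : AccRho) (π : DerivMode) : Set (ℕ → T) :=
  {u | ∃ (s : ℕ → List (G.N ⊕ T)) (d : ℕ → G.P),
    s 0 = [Sum.inl G.start] ∧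
    (∀ i : ℕ, G.StepOf π (d i) (s i) (s (i + 1))) ∧
    (∀ n : ℕ, ∃ i : ℕ, n ≤ (termPrefix (s i)).length) ∧
    (∀ i : ℕ, MatchesPrefix (termPrefix (s i)) u) ∧
    IsAccepting σ ρ G.acc d}

/-- context-free: every left-hand side is a single nonterminal. -/
def IsCFG : Prop := ∀ p : G.P, (G.lhs p).length = 1

/-- context-sensitive (monotonic): `|β| ≥ |α|` for every production. -/
def IsCSG : Prop := ∀ p : G.P, (G.lhs p).length ≤ (G.rhs p).length

/-- right linear: productions of the form `A → uB` or `A → u`, `u ∈ T*`. -/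
def IsRLG : Prop :=
  ∀ p : G.P, (G.lhs p).length = 1 ∧
    ∃ (w : List T) (B : Option G.N),
      G.rhs p = w.map Sum.inr ++ B.toList.map Sum.inl

/-- `G` is a grammar with `$`-boundary (PSG version): with `$` = `dollar`,
`S` = `S'`, every production has one of the forms
(1) α → β, α,β ∈ N⁺ (N = nonterminals other than `$`, `S`),
(2) S → $α, α ∈ N⁺, (3) $A → a$, (4) A → ε. -/
def HasDollarBoundary (dollar S' : G.N) : Prop :=
  dollar ≠ S' ∧ G.start = S' ∧
  ∀ p : G.P,
    ((dollar ∉ G.lhs p ∧ S' ∉ G.lhs p) ∧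
      ∃ β : List G.N, β ≠ [] ∧ dollar ∉ β ∧ S' ∉ β ∧ G.rhs p = β.map Sum.inl) ∨
    (G.lhs p = [S'] ∧ ∃ α : List G.N, α ≠ [] ∧ dollar ∉ α ∧ S' ∉ α ∧
      G.rhs p = Sum.inl dollar :: α.map Sum.inl) ∨
    (∃ A : G.N, A ≠ dollar ∧ A ≠ S' ∧ G.lhs p = [dollar, A] ∧
      ∃ a : T, G.rhs p = [Sum.inr a, Sum.inl dollar]) ∨
    (∃ A : G.N, A ≠ dollar ∧ A ≠ S' ∧ G.lhs p = [A] ∧ G.rhs p = [])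

/-- `G` is a grammar with `$`-boundary (CSG version): forms (1)-(3) only,
with `|α| ≤ |β|` in form (1). -/
def HasDollarBoundaryCSG (dollar S' : G.N) : Prop :=
  dollar ≠ S' ∧ G.start = S' ∧
  ∀ p : G.P,
    ((dollar ∉ G.lhs p ∧ S' ∉ G.lhs p) ∧
      ∃ β : List G.N, β ≠ [] ∧ dollar ∉ β ∧ S' ∉ β ∧ (G.lhs p).length ≤ β.length ∧
        G.rhs p = β.map Sum.inl) ∨
    (G.lhs p = [S'] ∧ ∃ α : List G.N, α ≠ [] ∧ dollar ∉ α ∧ S' ∉ α ∧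
      G.rhs p = Sum.inl dollar :: α.map Sum.inl) ∨
    (∃ A : G.N, A ≠ dollar ∧ A ≠ S' ∧ G.lhs p = [dollar, A] ∧
      ∃ a : T, G.rhs p = [Sum.inr a, Sum.inl dollar])

end OmegaPSG

/-- `𝓛_{σ,ρ,π}(X)` for the family `X` of ω-grammars over `T` satisfying `C`. -/
def GLang (T : Type) (C : OmegaPSG T → Prop) (σ : AccSigma) (ρ : AccRho) (π : DerivMode) :
    Set (Set (ℕ → T)) :=
  {L | ∃ G : OmegaPSG T, C G ∧ L = G.Lang σ ρ π}

/-- number of non-ε labels among `b 0, …, b (i-1)`. -/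
def someCount {A : Type _} (b : ℕ → Option A) (i : ℕ) : ℕ :=
  ((Finset.range i).filter fun j => (b j).isSome = true).card

/-- the (ε-allowing) label sequence `b` concatenates to the ω-word `u`. -/
def Spells {A : Type _} (b : ℕ → Option A) (u : ℕ → A) : Prop :=
  (∀ n : ℕ, ∃ i : ℕ, n ≤ someCount b i) ∧
  ∀ i : ℕ, ∀ a : A, b i = some a → a = u (someCount b i)

/-- A finite state ω-automaton `(Q, Σ, δ, q₀, 𝓕)`. -/
structure OmegaFSA (Sig : Type) where
  Q : Type
  [fintypeQ : Fintype Q]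
  init : Q
  trans : Q → Option Sig → Q → Prop
  acc : Set (Set Q)

/-- `L_{σ,ρ}(A)` for a finite state ω-automaton. -/
def OmegaFSA.Lang {Sig : Type} (A : OmegaFSA Sig) (σ : AccSigma) (ρ : AccRho) :
    Set (ℕ → Sig) :=
  {u | ∃ (r : ℕ → A.Q) (b : ℕ → Option Sig),
    r 0 = A.init ∧ (∀ i : ℕ, A.trans (r i) (b i) (r (i + 1))) ∧
    Spells b u ∧ IsAccepting σ ρ A.acc r}

/-- `𝓛_{σ,ρ}(ω-FSA)`. -/
def FSALang (Sig : Type) (σ : AccSigma) (ρ : AccRho) : Set (Set (ℕ → Sig)) :=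
  {L | ∃ A : OmegaFSA Sig, L = A.Lang σ ρ}

/-- A pushdown ω-automaton `(Q, Σ, Γ, δ, q₀, Z₀, 𝓕)`. -/
structure OmegaPDA (Sig : Type) where
  Q : Type
  [fintypeQ : Fintype Q]
  Γ : Type
  [fintypeΓ : Fintype Γ]
  init : Q
  Z0 : Γ
  trans : Q → Option Sig → Γ → Q → List Γ → Prop
  acc : Set (Set Q)

/-- `L_{σ,ρ}(D)` for a pushdown ω-automaton. -/
def OmegaPDA.Lang {Sig : Type} (D : OmegaPDA Sig) (σ : AccSigma) (ρ : AccRho) :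
    Set (ℕ → Sig) :=
  {u | ∃ (q : ℕ → D.Q) (st : ℕ → List D.Γ) (b : ℕ → Option Sig),
    q 0 = D.init ∧ st 0 = [D.Z0] ∧
    (∀ i : ℕ, ∃ (Z : D.Γ) (γ rest : List D.Γ),
      st i = Z :: rest ∧ D.trans (q i) (b i) Z (q (i + 1)) γ ∧ st (i + 1) = γ ++ rest) ∧
    Spells b u ∧ IsAccepting σ ρ D.acc q}

/-- `𝓛_{σ,ρ}(ω-PDA)`. -/
def PDALang (Sig : Type) (σ : AccSigma) (ρ : AccRho) : Set (Set (ℕ → Sig)) :=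
  {L | ∃ D : OmegaPDA Sig, L = D.Lang σ ρ}

/-- tape head moves. -/
inductive Move | L | R | S
deriving DecidableEq

def moveHead : Move → ℕ → ℕ
  | .L, n => n - 1
  | .R, n => n + 1
  | .S, n => n

/-- A single-tape Turing ω-machine `(Q, Σ, Γ, δ, q₀, 𝓕)` (Σ ⊆ Γ via `embed`). -/
structure OmegaTM (Sig : Type) where
  Q : Type
  [fintypeQ : Fintype Q]
  Γ : Type
  [fintypeΓ : Fintype Γ]
  embed : Sig → Γ
  embed_inj : Function.Injective embed
  init : Q
  trans : Q → Γ → Q → Γ → Move → Prop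
  acc : Set (Set Q)

/-- `L_{σ,ρ}(M)`: ω-words admitting a complete non-oscillating run whose state
sequence is (σ,ρ)-accepting. -/
def OmegaTM.Lang {Sig : Type} (M : OmegaTM Sig) (σ : AccSigma) (ρ : AccRho) :
    Set (ℕ → Sig) :=
  {u | ∃ (q : ℕ → M.Q) (tape : ℕ → ℕ → M.Γ) (pos : ℕ → ℕ),
    q 0 = M.init ∧ (∀ n : ℕ, tape 0 n = M.embed (u n)) ∧ pos 0 = 0 ∧
    (∀ i : ℕ, ∃ (g : M.Γ) (m : Move),
      M.trans (q i) (tape i (pos i)) (q (i + 1)) g m ∧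
      tape (i + 1) = Function.update (tape i) (pos i) g ∧
      pos (i + 1) = moveHead m (pos i)) ∧
    (∀ n : ℕ, ∃ i : ℕ, n ≤ pos i) ∧
    (∀ n : ℕ, ∃ i0 : ℕ, ∀ i : ℕ, i0 ≤ i → pos i ≠ n) ∧
    IsAccepting σ ρ M.acc q}

/-- `𝓛_{σ,ρ}(ω-TM)`. -/
def TMLang (Sig : Type) (σ : AccSigma) (ρ : AccRho) : Set (Set (ℕ → Sig)) :=
  {L | ∃ M : OmegaTM Sig, L = M.Lang σ ρ}

/-- An m-tape Turing ω-machine. -/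
structure OmegaMTM (m : ℕ) (Sig : Type) where
  Q : Type
  [fintypeQ : Fintype Q]
  Γ : Type
  [fintypeΓ : Fintype Γ]
  embed : Sig → Γ
  embed_inj : Function.Injective embed
  blank : Γ
  init : Q
  trans : Q → (Fin m → Γ) → Q → (Fin m → Γ) → (Fin m → Move) → Prop
  acc : Set (Set Q)

/-- `L_{σ,ρ}(M)` for an m-tape Turing ω-machine (`hm : 0 < m`; the input is on
the first tape, the other tapes are initially blank; the run must be complete
and non-oscillating on the first tape). -/
def OmegaMTM.Lang {m : ℕ} {Sig : Type} (M : OmegaMTM m Sig) (hm : 0 < m)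
    (σ : AccSigma) (ρ : AccRho) : Set (ℕ → Sig) :=
  {u | ∃ (q : ℕ → M.Q) (tape : ℕ → Fin m → ℕ → M.Γ) (pos : ℕ → Fin m → ℕ),
    q 0 = M.init ∧
    (∀ n : ℕ, tape 0 ⟨0, hm⟩ n = M.embed (u n)) ∧
    (∀ j : Fin m, j ≠ ⟨0, hm⟩ → ∀ n : ℕ, tape 0 j n = M.blank) ∧
    (∀ j : Fin m, pos 0 j = 0) ∧
    (∀ i : ℕ, ∃ (g : Fin m → M.Γ) (mv : Fin m → Move),
      M.trans (q i) (fun j => tape i j (pos i j)) (q (i + 1)) g mv ∧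
      (∀ j : Fin m, tape (i + 1) j = Function.update (tape i j) (pos i j) (g j)) ∧
      (∀ j : Fin m, pos (i + 1) j = moveHead (mv j) (pos i j))) ∧
    (∀ n : ℕ, ∃ i : ℕ, n ≤ pos i ⟨0, hm⟩) ∧
    (∀ n : ℕ, ∃ i0 : ℕ, ∀ i : ℕ, i0 ≤ i → pos i ⟨0, hm⟩ ≠ n) ∧
    IsAccepting σ ρ M.acc q}

/-- `𝓛_{σ,ρ}(m-ω-TM)`. -/
def MTMLang (Sig : Type) (m : ℕ) (hm : 0 < m) (σ : AccSigma) (ρ : AccRho) :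
    Set (Set (ℕ → Sig)) :=
  {L | ∃ M : OmegaMTM m Sig, L = M.Lang hm σ ρ}

/-- the ω-language `{aⁿbⁿ | n ≥ 1}^ω` over the alphabet `Bool`
(`false` = a, `true` = b). -/
def abLang : Set (ℕ → Bool) :=
  {u | ∃ n : ℕ → ℕ, (∀ i : ℕ, 1 ≤ n i) ∧
    ∀ i k : ℕ, k < 2 * n i →
      u ((∑ j ∈ Finset.range i, 2 * n j) + k) = decide (n i ≤ k)}

end OmegaFormal

namespace OmegaFormal

/-! ### Sequences and acceptance -/

theorem exists_seq_of_forall_exists {α : Type _} {I : ℕ → α → Prop} {R : ℕ → α → α → Prop}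
    {a₀ : α} (h₀ : I 0 a₀) (h : ∀ n a, I n a → ∃ b, I (n + 1) b ∧ R n a b) :
    ∃ f : ℕ → α, f 0 = a₀ ∧ ∀ n, I n (f n) ∧ R n (f n) (f (n + 1)) := by
  choose! next hI hR using h
  let f : ℕ → α := fun n => Nat.rec a₀ (fun n a => next n a) n
  have hf : ∀ n, I n (f n) := by
    intro n
    induction n with
    | zero => exact h₀
    | succ n ih => exact hI n _ ih
  exact ⟨f, rfl, fun n => ⟨hf n, hR n _ (hf n)⟩⟩

theorem exists_eq_and_succ_eq {J : ℕ → ℕ} (h₀ : J 0 = 0) (hle : ∀ n, J (n + 1) ≤ J n + 1)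
    (hub : ∀ j, ∃ n, j ≤ J n) (j : ℕ) : ∃ n, J n = j ∧ J (n + 1) = j + 1 := by
  classical
  have hex : ∃ n, j + 1 ≤ J n := hub (j + 1)
  have hspec := Nat.find_spec hex
  obtain ⟨n, hn⟩ : ∃ n, Nat.find hex = n + 1 := by
    refine Nat.exists_eq_succ_of_ne_zero fun h => ?_
    rw [h] at hspec
    omega
  have hmin := Nat.find_min hex (m := n) (by omega)
  have := hle n
  rw [hn] at hspec
  exact ⟨n, by omega, by omega⟩

/-- `ℓ` lists the entries of `d` in order, interspersed with `none`; `J n` counts the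
entries listed up to time `n`. -/
structure Interleaves {P : Type _} (ℓ : ℕ → Option P) (d : ℕ → P) (J : ℕ → ℕ) : Prop where
  label_zero : ℓ 0 = none
  count_zero : J 0 = 0
  step : ∀ n, (ℓ (n + 1) = none ∧ J (n + 1) = J n) ∨
    (ℓ (n + 1) = some (d (J n)) ∧ J (n + 1) = J n + 1)
  unbounded : ∀ j, ∃ n, j ≤ J n

namespace Interleaves

variable {P : Type _} {ℓ : ℕ → Option P} {d : ℕ → P} {J : ℕ → ℕ}

theorem congr {ℓ' : ℕ → Option P} (h : Interleaves ℓ d J) (he : ∀ n, ℓ' n = ℓ n) :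
    Interleaves ℓ' d J :=
  (funext he : ℓ' = ℓ) ▸ h

theorem monotone (h : Interleaves ℓ d J) : Monotone J :=
  monotone_nat_of_le_succ fun n => by rcases h.step n with h | h <;> omega

theorem count_le (h : Interleaves ℓ d J) (n : ℕ) : J n ≤ n := by
  induction n with
  | zero => exact h.count_zero.le
  | succ n ih => rcases h.step n with h | h <;> omega

theorem exists_count (h : Interleaves ℓ d J) (j : ℕ) : ∃ n, J n = j ∧ J (n + 1) = j + 1 :=
  exists_eq_and_succ_eq h.count_zero
    (fun n => by rcases h.step n with h | h <;> omega) h.unbounded j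

theorem exists_label (h : Interleaves ℓ d J) (j : ℕ) : ∃ n, j ≤ n ∧ ℓ (n + 1) = some (d j) := by
  obtain ⟨n, hn, hn'⟩ := h.exists_count j
  have := h.count_le n
  rcases h.step n with h | h
  · omega
  · exact ⟨n, by omega, hn ▸ h.1⟩

theorem exists_of_label (h : Interleaves ℓ d J) {n : ℕ} {p : P} (hn : ℓ n = some p) :
    ∃ m, n = m + 1 ∧ d (J m) = p := by
  cases n with
  | zero => simp [h.label_zero] at hn
  | succ m =>
    rcases h.step m with h | h
    · simp [h.1] at hn
    · exact ⟨m, rfl, Option.some.inj (h.1.symm.trans hn)⟩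

theorem some_mem_sigmaSet_iff (h : Interleaves ℓ d J) (σ : AccSigma) (p : P) :
    some p ∈ sigmaSet σ ℓ ↔ p ∈ sigmaSet σ d := by
  cases σ with
  | ran =>
    constructor
    · rintro ⟨n, hn⟩
      obtain ⟨m, -, hm⟩ := h.exists_of_label hn
      exact ⟨_, hm⟩
    · rintro ⟨j, rfl⟩
      obtain ⟨n, -, hn⟩ := h.exists_label j
      exact ⟨_, hn⟩
  | inf =>
    constructor
    · intro hp M
      obtain ⟨n₀, hn₀⟩ := h.unbounded M
      obtain ⟨n, hn, hpn⟩ := hp (n₀ + 1)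
      obtain ⟨m, rfl, hm⟩ := h.exists_of_label hpn
      exact ⟨J m, hn₀.trans (h.monotone (by omega)), hm⟩
    · intro hp N
      obtain ⟨j, hj, rfl⟩ := hp N
      obtain ⟨n, hn, hn'⟩ := h.exists_label j
      exact ⟨n + 1, by omega, hn'⟩

end Interleaves

theorem sigmaSet_comp {Q R : Type _} [Finite Q] (σ : AccSigma) (g : Q → R) (f : ℕ → Q) :
    sigmaSet σ (g ∘ f) = g '' sigmaSet σ f := by
  cases σ with
  | ran => exact Set.range_comp g f
  | inf =>
    ext r
    constructor
    · intro hr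
      by_contra hcon
      have hfin : ∀ q : Q, ∃ N, ∀ m, N ≤ m → f m = q → g q ≠ r := by
        intro q
        by_contra hq
        push Not at hq
        refine hcon ⟨q, fun n => ?_, ?_⟩
        · obtain ⟨m, hm, hmq, -⟩ := hq n
          exact ⟨m, hm, hmq⟩
        · obtain ⟨m, -, -, h⟩ := hq 0
          exact h
      choose N hN using hfin
      obtain ⟨B, hB⟩ := (Set.finite_range N).bddAbove
      obtain ⟨m, hm, hmr⟩ := hr B
      exact hN (f m) m ((hB ⟨_, rfl⟩).trans hm) rfl hmr
    · rintro ⟨q, hq, rfl⟩ n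
      obtain ⟨m, hm, rfl⟩ := hq n
      exact ⟨m, hm, rfl⟩

/-- The designated sets of states that pull acceptance of label sequences back along the
partial labelling `lab`. -/
def labelAcc {Q P : Type _} (ρ : AccRho) (lab : Q → Option P) (𝓕 : Set (Set P)) : Set (Set Q) :=
  match ρ with
  | .cap => {X | ∃ F ∈ 𝓕, X = {q | ∃ p ∈ F, lab q = some p}}
  | .sub => {X | ∃ F ∈ 𝓕, {p | some p ∈ lab '' X} ⊆ F}
  | .eq => {X | ∃ F ∈ 𝓕, {p | some p ∈ lab '' X} = F}

theorem isAccepting_labelAcc_iff {Q P : Type _} [Finite Q] {σ : AccSigma} {ρ : AccRho}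
    {lab : Q → Option P} {𝓕 : Set (Set P)} {f : ℕ → Q} {d : ℕ → P} {J : ℕ → ℕ}
    (h : Interleaves (lab ∘ f) d J) :
    IsAccepting σ ρ (labelAcc ρ lab 𝓕) f ↔ IsAccepting σ ρ 𝓕 d := by
  have key : {p | some p ∈ lab '' sigmaSet σ f} = sigmaSet σ d := by
    ext p
    rw [← sigmaSet_comp]
    exact h.some_mem_sigmaSet_iff σ p
  cases ρ with
  | cap =>
    constructor
    · rintro ⟨_, ⟨F, hF, rfl⟩, q, hq, p, hp, hqp⟩
      exact ⟨F, hF, p, key ▸ ⟨q, hq, hqp⟩, hp⟩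
    · rintro ⟨F, hF, p, hp, hpF⟩
      rw [← key] at hp
      obtain ⟨q, hq, hqp⟩ := hp
      exact ⟨_, ⟨F, hF, rfl⟩, q, hq, p, hpF, hqp⟩
  | sub =>
    constructor
    · rintro ⟨X, ⟨F, hF, hX⟩, hq⟩
      refine ⟨F, hF, ?_⟩
      rw [← key]
      exact fun p hp => hX (Set.image_mono hq hp)
    · rintro ⟨F, hF, hd⟩
      exact ⟨_, ⟨F, hF, key.trans_subset hd⟩, subset_rfl⟩
  | eq =>
    constructor
    · rintro ⟨X, ⟨F, hF, hX⟩, rfl⟩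
      exact ⟨F, hF, key.symm.trans hX⟩
    · rintro ⟨F, hF, hd⟩
      exact ⟨_, ⟨F, hF, key.trans hd⟩, rfl⟩

/-! ### Terminal prefixes -/

section TermPrefix

variable {N T : Type _}

theorem termPrefix_prefix_of_cons_inl (x v z : List (N ⊕ T)) (A : N) :
    termPrefix (x ++ Sum.inl A :: v) <+: termPrefix (x ++ z) := by
  induction x with
  | nil => exact List.nil_prefix
  | cons s x ih => cases s with
    | inl B => exact List.nil_prefix
    | inr a => exact (List.prefix_cons_inj a).2 ih

theorem length_termPrefix_le_of_cons_inl (x v : List (N ⊕ T)) (A : N) :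
    (termPrefix (x ++ Sum.inl A :: v)).length ≤ x.length := by
  induction x with
  | nil => simp [termPrefix]
  | cons s x ih => cases s with
    | inl B => simp [termPrefix]
    | inr a => simpa [termPrefix] using ih

theorem termPrefix_map_inr_append (l : List T) (x : List (N ⊕ T)) :
    termPrefix (l.map Sum.inr ++ x) = l ++ termPrefix x := by
  induction l with
  | nil => rfl
  | cons a l ih => simp [termPrefix, ih]

theorem exists_eq_cons_of_termPrefix_ne_nil {x : List (N ⊕ T)} (h : termPrefix x ≠ []) :
    ∃ a y, x = Sum.inr a :: y ∧ termPrefix x = a :: termPrefix y := by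
  match x, h with
  | Sum.inr a :: y, _ => exact ⟨a, y, rfl, rfl⟩

theorem MatchesPrefix.of_prefix {l m : List T} {u : ℕ → T} (hm : MatchesPrefix m u)
    (h : l <+: m) : MatchesPrefix l u := by
  intro k hk
  have := hm k (hk.trans_le h.length_le)
  rw [← this]
  simpa using h.getElem hk

theorem matchesPrefix_map_range (u : ℕ → T) (k : ℕ) : MatchesPrefix ((List.range k).map u) u := by
  intro i hi
  simp

end TermPrefix

namespace OmegaPSG

variable {T : Type} {G : OmegaPSG T}

theorem Step.exists_cons {p : G.P} {x y : List (G.N ⊕ T)} (h : G.Step p x y) :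
    ∃ (l v z : List (G.N ⊕ T)) (A : G.N), x = l ++ Sum.inl A :: v ∧ y = l ++ z := by
  obtain ⟨l, v, rfl, rfl⟩ := h
  obtain ⟨A, α, hα⟩ := List.exists_cons_of_ne_nil (G.lhs_ne p)
  exact ⟨l, α.map Sum.inl ++ v, G.rhs p ++ v, A, by simp [hα], by simp⟩

theorem Step.termPrefix_prefix {p : G.P} {x y : List (G.N ⊕ T)} (h : G.Step p x y) :
    termPrefix x <+: termPrefix y := by
  obtain ⟨l, v, z, A, rfl, rfl⟩ := h.exists_cons
  exact termPrefix_prefix_of_cons_inl l v z A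

/-! ### The simulating machine -/

/-- Letters of the working word: `none` is the left boundary marker. -/
abbrev Sym (G : OmegaPSG T) : Type := Option (G.N ⊕ T)

/-- Tape cells: `none` is an empty cell. -/
abbrev Cell (G : OmegaPSG T) : Type := Option G.Sym

def bufBound (G : OmegaPSG T) : ℕ :=
  letI := G.fintypeP
  2 + ∑ p : G.P, ((G.lhs p).length + (G.rhs p).length)

theorem two_le_bufBound (G : OmegaPSG T) : 2 ≤ G.bufBound := Nat.le_add_right _ _

theorem length_add_length_le_bufBound (G : OmegaPSG T) (p : G.P) :
    (G.lhs p).length + (G.rhs p).length ≤ G.bufBound := by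
  let := G.fintypeP
  have := Finset.single_le_sum (f := fun p : G.P => (G.lhs p).length + (G.rhs p).length)
    (fun _ _ => Nat.zero_le _) (Finset.mem_univ p)
  simp only [bufBound]
  omega

abbrev Buf (G : OmegaPSG T) : Type := {w : List G.Sym // w.length ≤ G.bufBound}

theorem finite_buf [Finite T] (G : OmegaPSG T) : Finite G.Buf := by
  let := G.fintypeN
  exact (List.finite_length_le G.Sym G.bufBound).to_subtype

theorem finite_state [Finite T] (G : OmegaPSG T) : Finite (Option G.P × G.Buf) := by
  let := G.fintypeP
  have := G.finite_buf
  infer_instance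

/-- `Local w x c l w' o m₁ m₂`: with buffer `w`, reading `x` on the first and `c` on the second
tape, the machine may pass to label `l` and buffer `w'`, write `o` on the second tape and move
its heads by `m₁` and `m₂`. -/
inductive Local (G : OmegaPSG T) : List G.Sym → G.Cell → G.Cell →
    Option G.P → List G.Sym → G.Cell → Move → Move → Prop
  | right {w x c w' o} (h : w ++ c.toList = o.toList ++ w') : Local G w x c none w' o .S .R
  | left {x c} : Local G [] x c none [] c .S .L
  | prod {x c} (p : G.P) : Local G (((G.lhs p).map Sum.inl).map some) x c
      (some p) ((G.rhs p).map some) c .S .S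
  | emit {c} (a : T) : Local G [none, some (Sum.inr a)] (some (some (Sum.inr a))) c
      none [none] c .R .S

/-- The 2-tape machine simulating `G`: the buffer, inserted at the head position into the
nonempty cells of the second tape, holds the boundary marker followed by the part of the
sentential form not yet matched against the input. -/
noncomputable def toMTM [Fintype T] (G : OmegaPSG T) (ρ : AccRho) : OmegaMTM 2 T :=
  letI := G.fintypeN
  letI := G.finite_state
  { Q := Option G.P × G.Buf
    fintypeQ := Fintype.ofFinite _
    Γ := G.Cell
    embed := fun a => some (some (Sum.inr a))
    embed_inj := fun a b h => by simpa using h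
    blank := none
    init := (none, ⟨[none, some (Sum.inl G.start)], G.two_le_bufBound⟩)
    trans := fun q r q' g mv => g 0 = r 0 ∧
      G.Local q.2.1 (r 0) (r 1) q'.1 q'.2.1 (g 1) (mv 0) (mv 1)
    acc := labelAcc ρ Prod.fst G.acc }

/-- A configuration of the machine: label, buffer, second tape left of the head (reversed),
second tape from the head on, and the number of matched input letters. -/
structure Cfg (G : OmegaPSG T) where
  lab : Option G.P
  buf : List G.Sym
  left : List G.Cell
  right : List G.Cell
  count : ℕ

/-- The contents of a tape with `L` (reversed) to the left of the head and `R` from the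
head on. -/
def tapeOf {α : Type _} (L R : List (Option α)) (n : ℕ) : Option α :=
  (L.reverse ++ R).getD n none

section Tape

variable {α : Type _}

theorem tapeOf_length (L R : List (Option α)) : tapeOf L R L.length = R.headD none := by
  cases R <;> simp [tapeOf]

theorem tapeOf_cons_left (c : Option α) (L R : List (Option α)) :
    tapeOf (c :: L) R = tapeOf L (c :: R) := by
  ext1 n
  simp [tapeOf]

theorem update_tapeOf (L R : List (Option α)) (o : Option α) :
    Function.update (tapeOf L R) L.length o = tapeOf L (o :: R.tail) := by
  ext1 n
  rcases lt_trichotomy n L.length with h | rfl | h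
  · rw [Function.update_of_ne h.ne]
    simp [tapeOf, List.getElem?_append_left, h]
  · simp [tapeOf]
  · rw [Function.update_of_ne h.ne']
    obtain ⟨m, rfl⟩ := Nat.exists_eq_add_of_lt h
    cases R <;> simp [tapeOf, List.getElem?_append_right, add_assoc]

theorem update_tapeOf_headD (L R : List (Option α)) :
    Function.update (tapeOf L R) L.length (R.headD none) = tapeOf L R := by
  rw [← tapeOf_length L R, Function.update_eq_self]

end Tape

/-- Steps of the machine on input `u`, in terms of configurations. -/
inductive CfgStep (G : OmegaPSG T) (u : ℕ → T) : G.Cfg → G.Cfg → Prop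
  | right {l w L R k w' o} (h : w ++ (R.headD none).toList = o.toList ++ w')
      (hw : w'.length ≤ G.bufBound) :
      CfgStep G u ⟨l, w, L, R, k⟩ ⟨none, w', o :: L, R.tail, k⟩
  | left {l c L R k} : CfgStep G u ⟨l, [], c :: L, R, k⟩ ⟨none, [], L, c :: R, k⟩
  | stay {l R k} : CfgStep G u ⟨l, [], [], R, k⟩ ⟨none, [], [], R, k⟩
  | prod {l L R k} (p : G.P) :
      CfgStep G u ⟨l, ((G.lhs p).map Sum.inl).map some, L, R, k⟩
        ⟨some p, (G.rhs p).map some, L, R, k⟩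
  | emit {l L R k} : CfgStep G u ⟨l, [none, some (Sum.inr (u k))], L, R, k⟩
      ⟨none, [none], L, R, k + 1⟩

def initCfg (G : OmegaPSG T) : G.Cfg := ⟨none, [none, some (Sum.inl G.start)], [], [], 0⟩

variable {u : ℕ → T}

theorem CfgStep.length_buf_le {a b : G.Cfg} (h : G.CfgStep u a b) :
    b.buf.length ≤ G.bufBound := by
  have h2 := G.two_le_bufBound
  cases h with
  | right h hw => exact hw
  | left => exact Nat.zero_le _
  | stay => exact Nat.zero_le _
  | prod p =>
    have := G.length_add_length_le_bufBound p
    simp only [List.length_map]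
    omega
  | emit => simp only [List.length_singleton]; omega

theorem CfgStep.count_le {a b : G.Cfg} (h : G.CfgStep u a b) : a.count ≤ b.count := by
  cases h <;> simp


theorem Local.exists_cfgStep {l l' : Option G.P} {w w' : List G.Sym} {L R : List G.Cell} {k : ℕ}
    {o : G.Cell} {m₁ m₂ : Move}
    (h : G.Local w (some (some (Sum.inr (u k)))) (R.headD none) l' w' o m₁ m₂)
    (hw : w'.length ≤ G.bufBound) :
    ∃ L' R' k', G.CfgStep u ⟨l, w, L, R, k⟩ ⟨l', w', L', R', k'⟩ ∧
      tapeOf L' R' = Function.update (tapeOf L R) L.length o ∧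
      k' = moveHead m₁ k ∧ L'.length = moveHead m₂ L.length := by
  generalize hx : (some (some (Sum.inr (u k))) : G.Cell) = x at h
  generalize hc : R.headD none = c at h
  cases h with
  | right h =>
    subst hc
    exact ⟨_, _, _, .right h hw, by rw [tapeOf_cons_left, update_tapeOf], rfl, rfl⟩
  | left =>
    subst hc
    rw [update_tapeOf_headD]
    cases L with
    | nil => exact ⟨_, _, _, .stay, rfl, rfl, rfl⟩
    | cons c L => exact ⟨_, _, _, .left, (tapeOf_cons_left c L R).symm, rfl, rfl⟩
  | prod p =>
    subst hc
    rw [update_tapeOf_headD]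
    exact ⟨_, _, _, .prod p, rfl, rfl, rfl⟩
  | emit a =>
    subst hc
    rw [update_tapeOf_headD]
    obtain rfl : u k = a := by simpa using hx
    exact ⟨_, _, _, .emit, rfl, rfl, rfl⟩

theorem CfgStep.exists_local {a b : G.Cfg} (h : G.CfgStep u a b) :
    ∃ o m₁ m₂, G.Local a.buf (some (some (Sum.inr (u a.count)))) (a.right.headD none)
        b.lab b.buf o m₁ m₂ ∧
      tapeOf b.left b.right = Function.update (tapeOf a.left a.right) a.left.length o ∧
      b.count = moveHead m₁ a.count ∧ b.left.length = moveHead m₂ a.left.length := by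
  cases h with
  | right h hw => exact ⟨_, _, _, .right h, by rw [tapeOf_cons_left, update_tapeOf], rfl, rfl⟩
  | left =>
    exact ⟨_, _, _, .left, by rw [update_tapeOf_headD, tapeOf_cons_left], rfl, rfl⟩
  | stay => exact ⟨_, _, _, .left, by rw [update_tapeOf_headD], rfl, rfl⟩
  | prod p => exact ⟨_, _, _, .prod p, by rw [update_tapeOf_headD], rfl, rfl⟩
  | emit => exact ⟨_, _, _, .emit _, by rw [update_tapeOf_headD], rfl, rfl⟩

/-! ### Configurations and sentential forms -/

def Cfg.word (a : G.Cfg) : List G.Sym :=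
  a.left.reverse.reduceOption ++ a.buf ++ a.right.reduceOption

/-- The configuration `a` represents the sentential form `s`. -/
def Cfg.Represents (u : ℕ → T) (a : G.Cfg) (s : List (G.N ⊕ T)) : Prop :=
  ∃ rest : List (G.N ⊕ T), a.word = none :: rest.map some ∧
    s = ((List.range a.count).map u).map Sum.inr ++ rest

theorem initCfg_represents (u : ℕ → T) : G.initCfg.Represents u [Sum.inl G.start] :=
  ⟨[Sum.inl G.start], rfl, rfl⟩

theorem Cfg.Represents.map_range_prefix {a : G.Cfg} {s : List (G.N ⊕ T)}
    (h : a.Represents u s) : (List.range a.count).map u <+: termPrefix s := by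
  obtain ⟨rest, -, rfl⟩ := h
  rw [termPrefix_map_inr_append]
  exact List.prefix_append _ _

theorem reduceOption_eq_headD_append_tail {α : Type _} (R : List (Option α)) :
    R.reduceOption = (R.headD none).toList ++ R.tail.reduceOption := by
  cases R with
  | nil => rfl
  | cons c R => cases c <;> rfl

theorem append_map_some_append_eq {α : Type _} {x y : List (Option α)} {z t : List α}
    (hz : z ≠ []) (h : x ++ z.map some ++ y = none :: t.map some) :
    ∃ x' y' : List α, x = none :: x'.map some ∧ y = y'.map some ∧ t = x' ++ z ++ y' := by
  cases x with
  | nil =>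
    obtain ⟨c, z, rfl⟩ := List.exists_cons_of_ne_nil hz
    simp at h
  | cons c x =>
    simp only [List.cons_append, List.cons.injEq] at h
    obtain ⟨rfl, h⟩ := h
    obtain ⟨t₁, y', rfl, h₁, rfl⟩ := List.map_eq_append_iff.1 h.symm
    obtain ⟨x', z', rfl, rfl, hz'⟩ := List.map_eq_append_iff.1 h₁
    have := List.map_injective_iff.2 (Option.some_injective α) hz'
    subst this
    exact ⟨x', y', rfl, rfl, rfl⟩

theorem append_marker_append_eq {α : Type _} {x y : List (Option α)} {c : α} {t : List α}
    (h : x ++ [none, some c] ++ y = none :: t.map some) :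
    x = [] ∧ ∃ t', t = c :: t' ∧ y = t'.map some := by
  cases x with
  | nil =>
    cases t with
    | nil => simp at h
    | cons b t =>
      simp only [List.nil_append, List.cons_append, List.map_cons, List.cons.injEq,
        Option.some.injEq, true_and] at h
      exact ⟨rfl, t, by rw [h.1], h.2⟩
  | cons b x =>
    have : none ∈ t.map some := by
      simp only [List.cons_append, List.cons.injEq] at h
      rw [← h.2]
      simp
    simp at this

/-- A step that neither applies a production nor matches an input letter. -/
def Silent (G : OmegaPSG T) (u : ℕ → T) (a b : G.Cfg) : Prop :=
  G.CfgStep u a b ∧ b.lab = none ∧ b.count = a.count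

theorem Silent.word_eq {a b : G.Cfg} (h : G.Silent u a b) : b.word = a.word := by
  obtain ⟨h, hl, hk⟩ := h
  cases h with
  | @right l w L R k w' o h hw =>
    simp only [Cfg.word, List.reverse_cons, List.reduceOption_append,
      List.reduceOption_singleton]
    rw [reduceOption_eq_headD_append_tail R, List.append_assoc _ o.toList, ← h]
    simp
  | @left l c L R k =>
    simp only [Cfg.word, List.reverse_cons, List.reduceOption_append,
      List.reduceOption_singleton, List.append_nil]
    rw [reduceOption_eq_headD_append_tail (c :: R)]
    simp
  | stay => rfl
  | prod p => simp at hl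
  | emit => simp at hk

theorem CfgStep.represents {a b : G.Cfg} {s : List (G.N ⊕ T)} (h : G.CfgStep u a b)
    (hs : a.Represents u s) :
    (b.lab = none ∧ b.Represents u s) ∨
      ∃ p s', b.lab = some p ∧ G.Step p s s' ∧ b.Represents u s' := by
  obtain ⟨rest, hw, rfl⟩ := hs
  by_cases hsil : b.lab = none ∧ b.count = a.count
  · refine .inl ⟨hsil.1, rest, ?_, by rw [hsil.2]⟩
    rw [Silent.word_eq ⟨h, hsil⟩, hw]
  cases h with
  | right h hw => simp at hsil
  | left => simp at hsil
  | stay => simp at hsil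
  | @prod l L R k p =>
    obtain ⟨x, y, hx, hy, rfl⟩ := append_map_some_append_eq (by simpa using G.lhs_ne p) hw
    refine .inr ⟨p, _, rfl, ⟨((List.range k).map u).map Sum.inr ++ x, y, by simp, rfl⟩,
      x ++ G.rhs p ++ y, ?_, by simp⟩
    simp only [Cfg.word] at hx hy ⊢
    simp [hx, hy]
  | @emit l L R k =>
    obtain ⟨hx, t, rfl, hy⟩ := append_marker_append_eq hw
    refine .inl ⟨rfl, t, ?_, by simp [List.range_succ]⟩
    simp only [Cfg.word] at hx hy ⊢
    simp [hx, hy]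

/-! ### From runs to derivations -/

theorem lang_of_run {σ : AccSigma} {ρ : AccRho} {a : ℕ → G.Cfg} (h₀ : a 0 = G.initCfg)
    (hstep : ∀ n, G.CfgStep u (a n) (a (n + 1))) (hub : ∀ N, ∃ n, N ≤ (a n).count)
    (hacc : ∀ d J, Interleaves (fun n => (a n).lab) d J → IsAccepting σ ρ G.acc d) :
    u ∈ G.Lang σ ρ .nl := by
  obtain ⟨s, hs₀, hs⟩ := exists_seq_of_forall_exists
    (I := fun n s => (a n).Represents u s)
    (R := fun n s s' => ((a (n + 1)).lab = none ∧ s' = s) ∨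
      ∃ p, (a (n + 1)).lab = some p ∧ G.Step p s s')
    (a₀ := [Sum.inl G.start]) (by rw [h₀]; exact initCfg_represents u) (by
      intro n s hs
      rcases (hstep n).represents hs with ⟨hl, hr⟩ | ⟨p, s', hl, hp, hr⟩
      · exact ⟨s, hr, .inl ⟨hl, rfl⟩⟩
      · exact ⟨s', hr, .inr ⟨p, hl, hp⟩⟩)
  have hrep : ∀ n, (a n).Represents u (s n) := fun n => (hs n).1
  have hpre : ∀ {m n}, m ≤ n → termPrefix (s m) <+: termPrefix (s n) := by
    intro m n hmn
    induction n, hmn using Nat.le_induction with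
    | base => exact List.prefix_rfl
    | succ n _ ih =>
      rcases (hs n).2 with ⟨-, he⟩ | ⟨p, -, hp⟩
      · rwa [he]
      · exact ih.trans hp.termPrefix_prefix
  have hcount : ∀ n, (a n).count ≤ (termPrefix (s n)).length := fun n => by
    simpa using (hrep n).map_range_prefix.length_le
  have hmono : Monotone fun n => (a n).count := monotone_nat_of_le_succ fun n => (hstep n).count_le
  have hmatch : ∀ n, MatchesPrefix (termPrefix (s n)) u := by
    intro n
    obtain ⟨m, hm⟩ := hub (termPrefix (s n)).length
    have hm' : (termPrefix (s n)).length ≤ (a (max m n)).count :=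
      hm.trans (hmono (le_max_left m n))
    refine (matchesPrefix_map_range u (a (max m n)).count).of_prefix ?_
    exact List.prefix_of_prefix_length_le (hpre (le_max_right m n)) (hrep _).map_range_prefix
      (by simpa using hm')
  let J : ℕ → ℕ := Nat.count fun n => (a (n + 1)).lab.isSome = true
  have hJ : ∀ n, ((a (n + 1)).lab = none ∧ J (n + 1) = J n ∧ s (n + 1) = s n) ∨
      ∃ p, (a (n + 1)).lab = some p ∧ J (n + 1) = J n + 1 ∧ G.Step p (s n) (s (n + 1)) := by
    intro n
    rcases (hs n).2 with ⟨hl, he⟩ | ⟨p, hl, hp⟩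
    · exact .inl ⟨hl, by simp [J, Nat.count_succ, hl], he⟩
    · exact .inr ⟨p, hl, by simp [J, Nat.count_succ, hl], hp⟩
  have hJmono : Monotone J := Nat.count_monotone _
  have hconst : ∀ {m n}, J m = J n → s m = s n := by
    intro m n
    wlog hmn : m ≤ n generalizing m n
    · exact fun h => (this (le_of_not_ge hmn) h.symm).symm
    induction n, hmn using Nat.le_induction with
    | base => exact fun _ => rfl
    | succ n hmn ih =>
      intro h
      have h1 := hJmono hmn
      rcases hJ n with ⟨-, hJn, he⟩ | ⟨p, -, hJn, -⟩
      · rw [he]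
        exact ih (h.trans hJn)
      · omega
  have hJub : ∀ j, ∃ n, j ≤ J n := by
    by_contra! ⟨j, hj⟩
    have hbdd : BddAbove (Set.range J) := ⟨j, by rintro _ ⟨n, rfl⟩; exact (hj n).le⟩
    obtain ⟨m, hm⟩ := Nat.sSup_mem (Set.range_nonempty J) hbdd
    obtain ⟨n, hn⟩ := hub ((termPrefix (s m)).length + 1)
    have hlen : (termPrefix (s m)).length + 1 ≤ (a (max m n)).count :=
      hn.trans (hmono (le_max_right m n))
    have hJeq : J (max m n) = J m :=
      le_antisymm (hm ▸ le_csSup hbdd ⟨_, rfl⟩) (hJmono (le_max_left m n))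
    have := hcount (max m n)
    rw [hconst hJeq] at this
    omega
  have hex : ∀ j, ∃ n, J n = j ∧ J (n + 1) = j + 1 :=
    exists_eq_and_succ_eq (Nat.count_zero _)
      (fun n => by rcases hJ n with h | ⟨p, h⟩ <;> omega) hJub
  choose t ht ht' using hex
  have hprod : ∀ j, ∃ p, (a (t j + 1)).lab = some p ∧ G.Step p (s (t j)) (s (t (j + 1))) := by
    intro j
    rcases hJ (t j) with ⟨-, h, -⟩ | ⟨p, hl, -, hp⟩
    · have h1 := ht j
      have h2 := ht' j
      omega
    · refine ⟨p, hl, ?_⟩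
      rwa [hconst ((ht (j + 1)).trans (ht' j).symm)]
  choose d hd hdstep using hprod
  refine ⟨fun j => s (t j), d, ?_, hdstep, ?_, fun j => hmatch _, hacc d J ⟨?_, ?_, ?_, hJub⟩⟩
  · rw [← hs₀]
    exact hconst ((ht 0).trans (Nat.count_zero _).symm)
  · intro N
    obtain ⟨n, hn⟩ := hub N
    refine ⟨J n, ?_⟩
    dsimp only
    rw [hconst (ht (J n))]
    exact hn.trans (hcount n)
  · simp [h₀, initCfg]
  · exact Nat.count_zero _
  · intro n
    rcases hJ n with ⟨hl, hJn, -⟩ | ⟨p, hl, hJn, -⟩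
    · exact .inl ⟨hl, hJn⟩
    · refine .inr ⟨?_, hJn⟩
      have htn : t (J n) = n := by
        have h1 := ht (J n)
        have h2 := ht' (J n)
        rcases lt_trichotomy (t (J n)) n with h | h | h
        · have := hJmono (Nat.succ_le_of_lt h)
          simp only [Nat.succ_eq_add_one] at this
          omega
        · exact h
        · have := hJmono (Nat.succ_le_of_lt h)
          simp only [Nat.succ_eq_add_one] at this
          omega
      rw [← hd (J n), htn]

/-! ### From derivations to runs -/

open Relation

theorem word_eq_of_silent {a b : G.Cfg} (h : ReflTransGen (G.Silent u) a b) :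
    b.word = a.word := by
  induction h with
  | refl => rfl
  | tail _ h ih => rw [h.word_eq, ih]

theorem count_eq_of_silent {a b : G.Cfg} (h : ReflTransGen (G.Silent u) a b) :
    b.count = a.count := by
  induction h with
  | refl => rfl
  | tail _ h ih => rw [h.2.2, ih]

theorem exists_silent_flush (a : G.Cfg) (ha : a.buf.length ≤ G.bufBound) :
    ∃ b, ReflTransGen (G.Silent u) a b ∧ b.buf = [] := by
  induction hn : a.right.length + a.buf.length using Nat.strong_induction_on generalizing a with
  | _ n ih =>
    obtain ⟨l, w, L, R, k⟩ := a
    dsimp only at ha hn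
    by_cases hw : w = []
    · exact ⟨_, .refl, hw⟩
    have hpos := List.length_pos_iff.2 hw
    have hlen : (w ++ (R.headD none).toList).tail.length ≤ w.length ∧
        R.tail.length + (w ++ (R.headD none).toList).tail.length < n := by
      rcases R with _ | ⟨_ | c, R⟩ <;>
        simp only [List.headD_nil, List.headD_cons, Option.toList_none, Option.toList_some,
          List.append_nil, List.tail_nil, List.tail_cons, List.length_tail, List.length_append,
          List.length_nil, List.length_cons] at hn ⊢ <;> omega
    obtain ⟨b, hb, hb'⟩ := ih _ hlen.2 ⟨none, (w ++ (R.headD none).toList).tail,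
      (w ++ (R.headD none).toList).head? :: L, R.tail, k⟩ (hlen.1.trans ha) rfl
    refine ⟨b, .head ⟨.right ?_ (hlen.1.trans ha), rfl, rfl⟩ hb, hb'⟩
    cases w ++ (R.headD none).toList <;> rfl

theorem exists_silent_rewind (a : G.Cfg) (ha : a.buf = []) :
    ∃ b, ReflTransGen (G.Silent u) a b ∧ b.buf = [] ∧ b.left = [] := by
  obtain ⟨l, w, L, R, k⟩ := a
  subst ha
  induction L generalizing l R with
  | nil => exact ⟨_, .refl, rfl, rfl⟩
  | cons c L ih =>
    obtain ⟨b, hb, hb'⟩ := ih none (c :: R)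
    exact ⟨b, .head ⟨.left, rfl, rfl⟩ hb, hb'⟩

theorem exists_silent_seek (a : G.Cfg) (ha : a.buf = []) {x y : List G.Sym}
    (hR : a.right.reduceOption = x ++ y) :
    ∃ b, ReflTransGen (G.Silent u) a b ∧ b.buf = [] ∧ b.right.reduceOption = y := by
  obtain ⟨l, w, L, R, k⟩ := a
  subst ha
  induction R generalizing l L x with
  | nil =>
    have : x ++ y = [] := hR.symm
    exact ⟨_, .refl, rfl, by simp_all⟩
  | cons c R ih =>
    have hsil : G.Silent u ⟨l, [], L, c :: R, k⟩ ⟨none, [], c :: L, R, k⟩ :=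
      ⟨.right (by simp) (Nat.zero_le _), rfl, rfl⟩
    cases x with
    | nil => exact ⟨_, .refl, rfl, hR⟩
    | cons s x =>
      cases c with
      | none =>
        obtain ⟨b, hb, hb'⟩ := ih none (none :: L) (x := s :: x) (by simpa using hR)
        exact ⟨b, .head hsil hb, hb'⟩
      | some c =>
        simp only [List.reduceOption_cons_of_some, List.cons_append, List.cons.injEq] at hR
        obtain ⟨b, hb, hb'⟩ := ih none (some c :: L) (x := x) hR.2
        exact ⟨b, .head hsil hb, hb'⟩

theorem exists_silent_absorb (a : G.Cfg) {z y : List G.Sym}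
    (hR : a.right.reduceOption = z ++ y) (hz : a.buf.length + z.length ≤ G.bufBound) :
    ∃ b, ReflTransGen (G.Silent u) a b ∧ b.buf = a.buf ++ z ∧ b.right.reduceOption = y := by
  obtain ⟨l, w, L, R, k⟩ := a
  dsimp only at hR hz ⊢
  induction R generalizing l w L z with
  | nil =>
    have : z ++ y = [] := hR.symm
    exact ⟨_, .refl, by simp_all, by simp_all⟩
  | cons c R ih =>
    cases z with
    | nil => exact ⟨_, .refl, by simp, hR⟩
    | cons s z =>
      simp only [List.length_cons] at hz
      cases c with
      | none =>
        obtain ⟨b, hb, hb'⟩ := ih none w (none :: L) (z := s :: z) (by simpa using hR) hz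
        exact ⟨b, .head ⟨.right (o := none) (by simp) (by omega), rfl, rfl⟩ hb, hb'⟩
      | some c =>
        simp only [List.reduceOption_cons_of_some, List.cons_append, List.cons.injEq] at hR
        obtain ⟨rfl, hR⟩ := hR
        obtain ⟨b, hb, hb₁, hb₂⟩ := ih none (w ++ [c]) (none :: L) hR (by simp; omega)
        exact ⟨b, .head ⟨.right (o := none) (by simp) (by simp; omega), rfl, rfl⟩ hb,
          by simpa using hb₁, hb₂⟩

theorem exists_silent_focus {a : G.Cfg} (ha : a.buf.length ≤ G.bufBound) {x z y : List G.Sym}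
    (hw : a.word = x ++ z ++ y) (hz : z.length ≤ G.bufBound) :
    ∃ l L R, ReflTransGen (G.Silent u) a ⟨l, z, L, R, a.count⟩ ∧
      L.reverse.reduceOption = x ∧ R.reduceOption = y := by
  obtain ⟨b, hab, hb⟩ := exists_silent_flush (u := u) a ha
  obtain ⟨c, hbc, hc, hcL⟩ := exists_silent_rewind (u := u) b hb
  have hac := hab.trans hbc
  have hcR : c.right.reduceOption = x ++ (z ++ y) := by
    rw [← List.append_assoc, ← hw, ← word_eq_of_silent hac]
    simp [Cfg.word, hc, hcL]
  obtain ⟨e, hce, he, heR⟩ := exists_silent_seek (u := u) c hc hcR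
  obtain ⟨f, hef, hf, hfR⟩ := exists_silent_absorb (u := u) e heR (by simpa [he] using hz)
  have haf := (hac.trans hce).trans hef
  have hword := (word_eq_of_silent haf).trans hw
  have hcount := count_eq_of_silent haf
  obtain ⟨l, w, L, R, k⟩ := f
  simp only [he, List.nil_append] at hf hfR hcount
  subst hf hcount
  refine ⟨l, L, R, haf, ?_, hfR⟩
  simpa [Cfg.word, hfR] using hword

/-- A step that does not apply a production. -/
def Quiet (G : OmegaPSG T) (u : ℕ → T) (a b : G.Cfg) : Prop :=
  G.CfgStep u a b ∧ b.lab = none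

theorem quiet_of_silent {a b : G.Cfg} (h : ReflTransGen (G.Silent u) a b) :
    ReflTransGen (G.Quiet u) a b :=
  ReflTransGen.mono (fun _ _ h => ⟨h.1, h.2.1⟩) _ _ h

theorem Cfg.Represents.eq_cons {a : G.Cfg} {s : List (G.N ⊕ T)} (hs : a.Represents u s)
    (hu : MatchesPrefix (termPrefix s) u) (hk : a.count < (termPrefix s).length) :
    ∃ t, a.word = none :: some (Sum.inr (u a.count)) :: t.map some ∧
      s = ((List.range (a.count + 1)).map u).map Sum.inr ++ t := by
  obtain ⟨rest, hw, rfl⟩ := hs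
  have hku := hu a.count hk
  simp only [termPrefix_map_inr_append, List.length_append, List.length_map,
    List.length_range] at hk
  obtain ⟨b, t, rfl, ht⟩ := exists_eq_cons_of_termPrefix_ne_nil (x := rest)
    (List.length_pos_iff.1 (by omega))
  obtain rfl : b = u a.count := by
    simpa only [termPrefix_map_inr_append, ht, List.get_eq_getElem, List.getElem_append_right,
      List.length_map, List.length_range, le_refl, Nat.sub_self, List.getElem_cons_zero] using hku
  exact ⟨t, by simpa using hw, by simp [List.range_succ]⟩

theorem exists_quiet_emit {a : G.Cfg} {s : List (G.N ⊕ T)} (ha : a.buf.length ≤ G.bufBound)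
    (hs : a.Represents u s) (hu : MatchesPrefix (termPrefix s) u)
    (hk : a.count ≤ (termPrefix s).length) :
    ∃ b, ReflTransGen (G.Quiet u) a b ∧ b.buf.length ≤ G.bufBound ∧ b.Represents u s ∧
      b.count = (termPrefix s).length := by
  induction hn : (termPrefix s).length - a.count generalizing a with
  | zero => exact ⟨a, .refl, ha, hs, by omega⟩
  | succ n ih =>
    obtain ⟨t, hw, he⟩ := hs.eq_cons hu (by omega)
    obtain ⟨l, L, R, hab, hL, hR⟩ := exists_silent_focus (u := u) ha (x := [])
      (z := [none, some (Sum.inr (u a.count))]) (y := t.map some) (by simpa using hw)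
      G.two_le_bufBound
    have hbc : G.CfgStep u ⟨l, [none, some (Sum.inr (u a.count))], L, R, a.count⟩
      ⟨none, [none], L, R, a.count + 1⟩ := .emit
    obtain ⟨b, hb, hb'⟩ := ih hbc.length_buf_le
      ⟨t, by simp [Cfg.word, hL, hR], he⟩ (by dsimp only; omega) (by dsimp only; omega)
    exact ⟨b, ((quiet_of_silent hab).tail ⟨hbc, rfl⟩).trans hb, hb'⟩

theorem exists_quiet_prod {a : G.Cfg} {s s' : List (G.N ⊕ T)} {p : G.P}
    (ha : a.buf.length ≤ G.bufBound) (hs : a.Represents u s) (hp : G.Step p s s') :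
    ∃ b c, ReflTransGen (G.Quiet u) a b ∧ G.CfgStep u b c ∧ c.lab = some p ∧
      c.Represents u s' ∧ c.count = a.count := by
  have hk : a.count ≤ (termPrefix s).length := by simpa using hs.map_range_prefix.length_le
  obtain ⟨rest, hw, he⟩ := hs
  obtain ⟨x, y, rfl, rfl⟩ := hp
  obtain ⟨A, α, hα⟩ := List.exists_cons_of_ne_nil (G.lhs_ne p)
  have hx : a.count ≤ x.length := by
    refine hk.trans ?_
    rw [hα]
    simpa using length_termPrefix_le_of_cons_inl x (α.map Sum.inl ++ y) A
  obtain ⟨x', rfl, rfl⟩ : ∃ x', x = ((List.range a.count).map u).map Sum.inr ++ x' ∧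
      rest = x' ++ (G.lhs p).map Sum.inl ++ y := by
    have hpre : ((List.range a.count).map u).map Sum.inr <+: x := by
      refine List.prefix_of_prefix_length_le (l₃ := x ++ (G.lhs p).map Sum.inl ++ y) ?_ ?_
        (by simpa using hx)
      · rw [he]
        exact List.prefix_append _ _
      · rw [List.append_assoc]
        exact List.prefix_append _ _
    obtain ⟨x', rfl⟩ := hpre
    refine ⟨x', rfl, ?_⟩
    simpa using he.symm
  have hlen := G.length_add_length_le_bufBound p
  obtain ⟨l, L, R, hab, hL, hR⟩ := exists_silent_focus (u := u) ha (x := none :: x'.map some)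
    (z := ((G.lhs p).map Sum.inl).map some) (y := y.map some) (by simpa using hw)
    (by simp only [List.length_map]; omega)
  exact ⟨_, _, quiet_of_silent hab, .prod p, rfl,
    ⟨x' ++ G.rhs p ++ y, by simp [Cfg.word, hL, hR], by simp⟩, rfl⟩

/-- From `a` the machine can, after `m` quiet steps, apply the `j`-th production of the
derivation `s`, `d`, with all terminals of `s j` matched. -/
def Ready (u : ℕ → T) (s : ℕ → List (G.N ⊕ T)) (d : ℕ → G.P) (j : ℕ) : ℕ → G.Cfg → Prop
  | 0, a => ∃ b, G.CfgStep u a b ∧ b.lab = some (d j) ∧ b.Represents u (s (j + 1)) ∧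
      b.count = (termPrefix (s j)).length
  | m + 1, a => ∃ b, G.Quiet u a b ∧ Ready u s d j m b

theorem exists_ready {s : ℕ → List (G.N ⊕ T)} {d : ℕ → G.P}
    (hstep : ∀ j, G.Step (d j) (s j) (s (j + 1)))
    (hu : ∀ j, MatchesPrefix (termPrefix (s j)) u) {a : G.Cfg} {j : ℕ}
    (ha : a.buf.length ≤ G.bufBound) (hs : a.Represents u (s j)) :
    ∃ m, Ready u s d j m a := by
  obtain ⟨b, hab, hb, hbs, hbk⟩ := exists_quiet_emit ha hs (hu j)
    (by simpa using hs.map_range_prefix.length_le)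
  obtain ⟨c, e, hbc, hce, hl, hes, hek⟩ := exists_quiet_prod hb hbs (hstep j)
  refine (hab.trans hbc).head_induction_on ?_ ?_
  · exact ⟨0, e, hce, hl, hes, hek.trans hbk⟩
  · rintro x y hxy - ⟨m, hm⟩
    exact ⟨m + 1, y, hxy, hm⟩

theorem exists_run {s : ℕ → List (G.N ⊕ T)} {d : ℕ → G.P}
    (hs₀ : s 0 = [Sum.inl G.start]) (hstep : ∀ j, G.Step (d j) (s j) (s (j + 1)))
    (hub : ∀ n, ∃ j, n ≤ (termPrefix (s j)).length)
    (hu : ∀ j, MatchesPrefix (termPrefix (s j)) u) :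
    ∃ (a : ℕ → G.Cfg) (J : ℕ → ℕ), a 0 = G.initCfg ∧ (∀ n, G.CfgStep u (a n) (a (n + 1))) ∧
      (∀ N, ∃ n, N ≤ (a n).count) ∧ Interleaves (fun n => (a n).lab) d J := by
  obtain ⟨m₀, hm₀⟩ := exists_ready hstep hu (a := G.initCfg) (j := 0) G.two_le_bufBound
    (by rw [hs₀]; exact initCfg_represents u)
  obtain ⟨f, hf₀, hf⟩ := exists_seq_of_forall_exists
    (α := G.Cfg × ℕ × ℕ) (a₀ := (G.initCfg, 0, m₀))
    (I := fun _ x => Ready u s d x.2.1 x.2.2 x.1)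
    (R := fun _ x y => G.CfgStep u x.1 y.1 ∧
      ((y.1.lab = none ∧ y.2.1 = x.2.1 ∧ x.2.2 = y.2.2 + 1) ∨
        (y.1.lab = some (d x.2.1) ∧ y.2.1 = x.2.1 + 1 ∧
          y.1.count = (termPrefix (s x.2.1)).length))) hm₀ (by
      rintro - ⟨a, j, _ | m⟩ h
      · obtain ⟨b, hab, hl, hb, hk⟩ := h
        obtain ⟨m, hm⟩ := exists_ready hstep hu hab.length_buf_le hb
        exact ⟨(b, j + 1, m), hm, hab, .inr ⟨hl, rfl, hk⟩⟩
      · obtain ⟨b, hab, hm⟩ := h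
        exact ⟨(b, j, m), hm, hab.1, .inl ⟨hab.2, rfl, rfl⟩⟩)
  have hnext : ∀ m n, (f n).2.2 = m → ∃ n', (f n').2.1 = (f n).2.1 + 1 := by
    intro m
    induction m with
    | zero =>
      intro n hn
      rcases (hf n).2.2 with ⟨-, -, h⟩ | ⟨-, h, -⟩
      · omega
      · exact ⟨n + 1, h⟩
    | succ m ih =>
      intro n hn
      rcases (hf n).2.2 with ⟨-, hj, h⟩ | ⟨-, h, -⟩
      · obtain ⟨n', hn'⟩ := ih (n + 1) (by omega)
        exact ⟨n', by omega⟩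
      · exact ⟨n + 1, h⟩
  have hJ : Interleaves (fun n => (f n).1.lab) d (fun n => (f n).2.1) := by
    refine ⟨by simp [hf₀, initCfg], by simp [hf₀], fun n => ?_, fun j => ?_⟩
    · rcases (hf n).2.2 with ⟨hl, hj, -⟩ | ⟨hl, hj, -⟩
      · exact .inl ⟨hl, hj⟩
      · exact .inr ⟨hl, hj⟩
    · induction j with
      | zero => exact ⟨0, Nat.zero_le _⟩
      | succ j ih =>
        obtain ⟨n, hn⟩ := ih
        obtain ⟨n', hn'⟩ := hnext _ n rfl
        exact ⟨n', by omega⟩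
  refine ⟨fun n => (f n).1, fun n => (f n).2.1, by simp [hf₀], fun n => (hf n).2.1, ?_, hJ⟩
  intro N
  obtain ⟨j, hj⟩ := hub N
  obtain ⟨n, hn, hn'⟩ := hJ.exists_count j
  refine ⟨n + 1, ?_⟩
  rcases (hf n).2.2 with ⟨-, h, -⟩ | ⟨-, -, h⟩
  · omega
  · rw [h, hn]
    exact hj

/-! ### The machine accepts the language of the grammar -/

theorem toMTM_lang_subset [Fintype T] (G : OmegaPSG T) (hm : 0 < 2) (σ : AccSigma)
    (ρ : AccRho) : (G.toMTM ρ).Lang hm σ ρ ⊆ G.Lang σ ρ .nl := by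
  rintro u ⟨q, tape, pos, hq₀, ht₀, hb₀, hp₀, hstep, hub, -, hacc⟩
  have := G.finite_state
  change ℕ → Option G.P × G.Buf at q
  change ℕ → Fin 2 → ℕ → G.Cell at tape
  have hrun : ∀ n, ∃ (g : Fin 2 → G.Cell) (mv : Fin 2 → Move),
      (g 0 = tape n 0 (pos n 0) ∧ G.Local (q n).2.1 (tape n 0 (pos n 0)) (tape n 1 (pos n 1))
        (q (n + 1)).1 (q (n + 1)).2.1 (g 1) (mv 0) (mv 1)) ∧
      (∀ j, tape (n + 1) j = Function.update (tape n j) (pos n j) (g j)) ∧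
      (∀ j, pos (n + 1) j = moveHead (mv j) (pos n j)) := hstep
  have hb₁ : ∀ i, tape 0 1 i = none := hb₀ 1 Fin.zero_ne_one.symm
  have hb : tape 0 1 = tapeOf G.initCfg.left G.initCfg.right :=
    funext fun i => by simp [hb₁, tapeOf, initCfg]
  obtain ⟨a, ha₀, ha⟩ := exists_seq_of_forall_exists (a₀ := G.initCfg)
    (I := fun n a => (q n).1 = a.lab ∧ (q n).2.1 = a.buf ∧
      (∀ i, tape n 0 i = some (some (Sum.inr (u i)))) ∧ tape n 1 = tapeOf a.left a.right ∧
      pos n 0 = a.count ∧ pos n 1 = a.left.length)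
    (R := fun _ a b => G.CfgStep u a b)
    ⟨congrArg Prod.fst hq₀, congrArg (fun q => q.2.1) hq₀, ht₀, hb, hp₀ 0, hp₀ 1⟩ (by
    rintro n ⟨l, w, L, R, k⟩ ⟨h1, h2, h3, h4, h5, h6⟩
    obtain ⟨g, mv, ⟨hg, hloc⟩, htape, hpos⟩ := hrun n
    dsimp only at h1 h2 h4 h5 h6
    have hloc' : G.Local w (some (some (Sum.inr (u k)))) (R.headD none)
        (q (n + 1)).1 (q (n + 1)).2.1 (g 1) (mv 0) (mv 1) := by
      rw [← tapeOf_length L R, ← h4, ← h6, ← h5, ← h3, ← h2]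
      exact hloc
    obtain ⟨L', R', k', hst, htp, hk, hL⟩ :=
      hloc'.exists_cfgStep (l := l) (L := L) (q (n + 1)).2.2
    refine ⟨_, ⟨rfl, rfl, ?_, ?_, ?_, ?_⟩, hst⟩
    · intro i
      rw [htape 0, hg, Function.update_eq_self, h3]
    · rw [htape 1, h4, h6, htp]
    · rw [hpos 0, h5, hk]
    · rw [hpos 1, h6, hL])
  refine lang_of_run ha₀ (fun n => (ha n).2) (fun N => ?_) fun d J h => ?_
  · obtain ⟨n, hn⟩ := hub N
    exact ⟨n, hn.trans (ha n).1.2.2.2.2.1.le⟩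
  · exact (isAccepting_labelAcc_iff (h.congr fun n => (ha n).1.1)).1 hacc

theorem lang_subset_toMTM [Fintype T] (G : OmegaPSG T) (hm : 0 < 2) (σ : AccSigma)
    (ρ : AccRho) : G.Lang σ ρ .nl ⊆ (G.toMTM ρ).Lang hm σ ρ := by
  rintro u ⟨s, d, hs₀, hstep, hub, hu, hacc⟩
  have := G.finite_state
  obtain ⟨a, J, ha₀, ha, hk, hJ⟩ := exists_run hs₀ hstep hub hu
  have hbuf : ∀ n, (a n).buf.length ≤ G.bufBound := by
    rintro (_ | n)
    · rw [ha₀]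
      exact G.two_le_bufBound
    · exact (ha n).length_buf_le
  have hmono : Monotone fun n => (a n).count := monotone_nat_of_le_succ fun n => (ha n).count_le
  refine ⟨fun n => ((a n).lab, ⟨(a n).buf, hbuf n⟩),
    fun n => ![fun i => some (some (Sum.inr (u i))), tapeOf (a n).left (a n).right],
    fun n => ![(a n).count, (a n).left.length], ?_, fun n => rfl, ?_, ?_, ?_, hk, ?_, ?_⟩
  · simp only [ha₀]
    rfl
  · intro j hj i
    obtain rfl : j = 1 := Fin.eq_one_of_ne_zero j hj
    simp only [ha₀]
    rfl
  · intro j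
    simp only [ha₀]
    fin_cases j <;> rfl
  · intro n
    obtain ⟨o, m₁, m₂, hloc, htp, hc, hL⟩ := (ha n).exists_local
    refine ⟨![some (some (Sum.inr (u (a n).count))), o], ![m₁, m₂], ⟨rfl, ?_⟩, ?_, ?_⟩
    · rw [← tapeOf_length (a n).left] at hloc
      exact hloc
    · intro j
      fin_cases j
      · exact (Function.update_eq_self _ _).symm
      · exact htp
    · intro j
      fin_cases j
      · exact hc
      · exact hL
  · intro N
    obtain ⟨n₀, hn₀⟩ := hk (N + 1)
    exact ⟨n₀, fun n hn => (lt_of_lt_of_le hn₀ (hmono hn)).ne'⟩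
  · exact (isAccepting_labelAcc_iff (lab := Prod.fst) (hJ.congr fun _ => rfl)).2 hacc

end OmegaPSG
end OmegaFormal

open OmegaFormal

/-- Lemma: 𝓛_{σ,ρ,nl}(ω-PSG) ⊆ 𝓛_{σ,ρ}(2-ω-TM) for every acceptance mode (σ,ρ). -/
theorem psg_nl_subset_2tm (T : Type) [Fintype T] (σ : AccSigma) (ρ : AccRho) :
    GLang T (fun _ => True) σ ρ DerivMode.nl ⊆ MTMLang T 2 (by norm_num) σ ρ := by
  rintro L ⟨G, -, rfl⟩
  exact ⟨G.toMTM ρ, (G.lang_subset_toMTM _ σ ρ).antisymm (G.toMTM_lang_subset _ σ ρ)⟩
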